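/- arXiv:2201.06601 — 2 statements merged into one kernel-verified Lean document; each statement's English description precedes it below -/
import Mathlib

section
/- Let a, b be real numbers with 0 < a < 1 and let s = a + ib. If ζ(s) = 0, then b/((a−1)² + b²) = ∫₁^∞ {x} · sin(b·ln(x)) / x^{1+a} dx. -/
section FractIntegral

open MeasureTheory Set Filter Topology Complex

lemma fractIndicator_locallyIntegrableOn :
    LocallyIntegrableOn ((Ioi (1 : ℝ)).indicator fun x ↦ ((Int.fract x : ℝ) : ℂ)) (Ioi 0) := by
  refine LocallyIntegrable.locallyIntegrableOn ?_ _
  refine (locallyIntegrable_const (1 : ℝ)).mono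
    (((measurable_ofReal.comp measurable_fract).indicator
      measurableSet_Ioi).aestronglyMeasurable) (ae_of_all _ fun x ↦ ?_)
  refine (norm_indicator_le_norm_self _ x).trans ?_
  rw [norm_real, norm_one, Real.norm_of_nonneg (Int.fract_nonneg x)]
  exact (Int.fract_lt_one x).le

lemma fractIndicator_isBigO_atTop :
    ((Ioi (1 : ℝ)).indicator fun x ↦ ((Int.fract x : ℝ) : ℂ)) =O[atTop] fun x : ℝ ↦ x ^ (-(0 : ℝ)) := by
  refine Asymptotics.IsBigO.of_bound 1 (Eventually.of_forall fun x ↦ ?_)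
  refine (norm_indicator_le_norm_self _ x).trans ?_
  rw [norm_real, Real.norm_of_nonneg (Int.fract_nonneg x)]
  simpa using (Int.fract_lt_one x).le

lemma fractIndicator_isBigO_zero (b : ℝ) :
    ((Ioi (1 : ℝ)).indicator fun x ↦ ((Int.fract x : ℝ) : ℂ)) =O[𝓝[>] 0] fun x : ℝ ↦ x ^ (-b) := by
  refine EventuallyEq.trans_isBigO (f₂ := fun _ ↦ (0 : ℂ)) ?_ (Asymptotics.isBigO_zero _ _)
  filter_upwards [mem_nhdsWithin_of_mem_nhds (Iio_mem_nhds (zero_lt_one (α := ℝ)))] with x hx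
  exact indicator_of_notMem (not_lt.mpr (le_of_lt hx)) _

lemma mellin_fractIndicator (s : ℂ) :
    mellin ((Ioi (1 : ℝ)).indicator fun x ↦ ((Int.fract x : ℝ) : ℂ)) (-s) =
      ∫ x : ℝ in Ioi 1, ((Int.fract x : ℝ) : ℂ) * (x : ℂ) ^ (-s - 1) := by
  have h (x : ℝ) : (x : ℂ) ^ (-s - 1) • (Ioi (1 : ℝ)).indicator (fun x ↦ ((Int.fract x : ℝ) : ℂ)) x =
      (Ioi (1 : ℝ)).indicator (fun x ↦ ((Int.fract x : ℝ) : ℂ) * (x : ℂ) ^ (-s - 1)) x := by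
    by_cases hx : x ∈ Ioi (1 : ℝ) <;> simp [hx, mul_comm]
  simp_rw [mellin, h]
  rw [setIntegral_indicator measurableSet_Ioi, Ioi_inter_Ioi]
  simp

lemma integrableOn_fract_mul_cpow {s : ℂ} (hs : 0 < s.re) :
    IntegrableOn (fun x : ℝ ↦ ((Int.fract x : ℝ) : ℂ) * (x : ℂ) ^ (-s - 1)) (Ioi 1) := by
  have h := mellinConvergent_of_isBigO_rpow (s := -s) fractIndicator_locallyIntegrableOn
    fractIndicator_isBigO_atTop (by simpa using hs) (fractIndicator_isBigO_zero ((-s).re - 1))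
    (by linarith)
  refine (IntegrableOn.mono_set h (Ioi_subset_Ioi zero_le_one)).congr_fun (fun x hx ↦ ?_)
    measurableSet_Ioi
  simp [indicator_of_mem hx, mul_comm]

lemma differentiableOn_integral_fract_mul_cpow :
    DifferentiableOn ℂ
      (fun s : ℂ ↦ ∫ x : ℝ in Ioi 1, ((Int.fract x : ℝ) : ℂ) * (x : ℂ) ^ (-s - 1)) {s | 0 < s.re} := by
  intro s hs
  simp_rw [← mellin_fractIndicator]
  have h := mellin_differentiableAt_of_isBigO_rpow (s := -s) fractIndicator_locallyIntegrableOn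
    fractIndicator_isBigO_atTop (by simpa using hs) (fractIndicator_isBigO_zero ((-s).re - 1))
    (by linarith)
  exact (h.comp s differentiableAt_id.neg).differentiableWithinAt

lemma riemannZeta_eq_sub_integral_of_one_lt_re {s : ℂ} (hs : 1 < s.re) :
    riemannZeta s = s * (1 / (s - 1) -
      ∫ x : ℝ in Ioi 1, ((Int.fract x : ℝ) : ℂ) * (x : ℂ) ^ (-s - 1)) := by
  have hre : (-s).re < -1 := by simpa using hs
  have hpow : ∫ x : ℝ in Ioi 1, (x : ℂ) ^ (-s) = 1 / (s - 1) := by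
    rw [integral_Ioi_cpow_of_lt hre zero_lt_one, ofReal_one, one_cpow,
      show -s + 1 = -(s - 1) by ring, neg_div_neg_eq]
  have hsum := LSeries_eq_mul_integral (fun _ ↦ (1 : ℂ)) zero_le_one hs
    (LSeriesSummable_one_iff.mpr hs) (by
      refine Asymptotics.IsBigO.of_bound 1 (Eventually.of_forall fun n ↦ ?_)
      simp)
  rw [← LSeries_one_eq_riemannZeta hs, ← hpow,
    ← integral_sub (integrableOn_Ioi_cpow_of_lt hre zero_lt_one)
      (integrableOn_fract_mul_cpow (zero_lt_one.trans hs))]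
  refine hsum.trans (congrArg (s * ·) (setIntegral_congr_fun measurableSet_Ioi fun x hx ↦ ?_))
  have hx0 : 0 < x := zero_lt_one.trans hx
  have hfl : ((⌊x⌋₊ : ℝ) : ℂ) = x - Int.fract x := by
    rw [← ofReal_sub, Int.self_sub_fract, natCast_floor_eq_intCast_floor hx0.le]
  have hpow_succ : (x : ℂ) ^ (-s) = x * (x : ℂ) ^ (-s - 1) := by
    rw [cpow_sub _ _ (ofReal_ne_zero.mpr hx0.ne'), cpow_one]
    field_simp [ofReal_ne_zero.mpr hx0.ne']
  rw [ofReal_natCast] at hfl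
  simp only [Finset.sum_const, Nat.card_Icc, add_tsub_cancel_right, nsmul_eq_mul, mul_one, hfl,
    hpow_succ, neg_add']
  ring

theorem riemannZeta_eq_sub_integral {s : ℂ} (hs : 0 < s.re) (hs1 : s ≠ 1) :
    riemannZeta s = s * (1 / (s - 1) -
      ∫ x : ℝ in Ioi 1, ((Int.fract x : ℝ) : ℂ) * (x : ℂ) ^ (-s - 1)) := by
  have hopen : IsOpen {z : ℂ | 0 < z.re} := isOpen_lt continuous_const continuous_re
  have h := AnalyticOnNhd.eqOn_of_preconnected_of_eventuallyEq
    (f := riemannZeta₁)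
    (g := fun z ↦ z * (1 - (z - 1) *
      ∫ x : ℝ in Ioi 1, ((Int.fract x : ℝ) : ℂ) * (x : ℂ) ^ (-z - 1)))
    (differentiable_riemannZeta₁.differentiableOn.analyticOnNhd hopen)
    (DifferentiableOn.analyticOnNhd (by
      have := differentiableOn_integral_fract_mul_cpow
      fun_prop) hopen)
    (convex_halfSpace_re_gt 0).isPreconnected (z₀ := 2) (by simp) (by
      filter_upwards [(isOpen_lt continuous_const continuous_re).mem_nhds
        (show (1 : ℝ) < (2 : ℂ).re by simp)] with z (hz : 1 < z.re)
      have hz1 : z - 1 ≠ 0 := sub_ne_zero.mpr (by rintro rfl; simp at hz)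
      have h1 := riemannZeta_eq_sub_integral_of_one_lt_re hz
      rw [riemannZeta_eq_inv_sub_mul (sub_ne_zero.mp hz1)] at h1
      field_simp at h1
      exact h1) hs
  have hs1' := sub_ne_zero.mpr hs1
  rw [riemannZeta_eq_inv_sub_mul hs1, h]
  field_simp

lemma im_fract_mul_cpow (a b : ℝ) {x : ℝ} (hx : 0 < x) :
    (((Int.fract x : ℝ) : ℂ) * (x : ℂ) ^ (-((a : ℂ) + b * I) - 1)).im =
      -(Int.fract x * Real.sin (b * Real.log x) / x ^ (1 + a)) := by
  have h : (x : ℂ) ^ (-((a : ℂ) + b * I) - 1) =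
      ((x ^ (-(1 + a)) : ℝ) : ℂ) * exp ((-(b * Real.log x) : ℝ) * I) := by
    rw [ofReal_cpow hx.le, cpow_def_of_ne_zero (ofReal_ne_zero.mpr hx.ne'),
      cpow_def_of_ne_zero (ofReal_ne_zero.mpr hx.ne'), ← exp_add, ← ofReal_log hx.le]
    congr 1
    push_cast
    ring
  rw [h, im_ofReal_mul, im_ofReal_mul, exp_ofReal_mul_I_im, Real.sin_neg, Real.rpow_neg hx.le]
  ring

end FractIntegral

theorem im_part_eq_one (a b : ℝ) (h0 : 0 < a) (h1 : a < 1)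
    (hz : riemannZeta (a + b * Complex.I) = 0) :
    b / ((a - 1) ^ 2 + b ^ 2) =
      ∫ x : ℝ in Set.Ioi (1 : ℝ), Int.fract x * Real.sin (b * Real.log x) / x ^ (1 + a) := by
  have hre : 0 < ((a : ℂ) + b * Complex.I).re := by simpa using h0
  have hne0 : (a : ℂ) + b * Complex.I ≠ 0 := Complex.ne_zero_of_re_pos hre
  have hne1 : (a : ℂ) + b * Complex.I ≠ 1 := fun h ↦ by
    have := congrArg Complex.re h
    simp at this
    exact h1.ne this
  rw [riemannZeta_eq_sub_integral hre hne1, mul_eq_zero, or_iff_right hne0, sub_eq_zero] at hz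
  have him := congrArg Complex.im hz
  have hint := integral_im (integrableOn_fract_mul_cpow hre)
  simp only [RCLike.im_to_complex] at hint
  rw [← hint, MeasureTheory.setIntegral_congr_fun measurableSet_Ioi
    fun x hx ↦ im_fract_mul_cpow a b (zero_lt_one.trans hx), MeasureTheory.integral_neg,
    one_div, Complex.inv_im] at him
  simp only [Complex.normSq_apply, Complex.sub_im, Complex.sub_re, Complex.add_im, Complex.add_re,
    Complex.ofReal_re, Complex.ofReal_im, Complex.re_ofReal_mul, Complex.im_ofReal_mul,
    Complex.I_re, Complex.I_im, Complex.one_re, Complex.one_im, mul_zero, mul_one, zero_add,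
    add_zero, sub_zero, neg_div, neg_inj] at him
  rw [← him]
  ring
end

section
/- Let a, b be real numbers with 0 < a < 1 and let s = a + ib. If ζ(s) = 0, then b/(a² + b²) = ∫₁^∞ {x} · sin(b·ln(x)) / x^{2−a} dx. -/
open Complex MeasureTheory Set Filter Asymptotics Topology

/-- The fractional part, truncated to `(1, ∞)`. -/
noncomputable def fractIoi : ℝ → ℂ := (Ioi (1 : ℝ)).indicator fun x ↦ ((Int.fract x : ℝ) : ℂ)

lemma norm_fractIoi_le (x : ℝ) : ‖fractIoi x‖ ≤ 1 := by
  refine (norm_indicator_le_norm_self _ _).trans ?_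
  rw [norm_real, Real.norm_of_nonneg (Int.fract_nonneg x)]
  exact (Int.fract_lt_one x).le

lemma measurable_fractIoi : Measurable fractIoi :=
  (measurable_ofReal.comp measurable_fract).indicator measurableSet_Ioi

lemma locallyIntegrable_fractIoi : LocallyIntegrable fractIoi :=
  (locallyIntegrable_const (1 : ℝ)).mono measurable_fractIoi.aestronglyMeasurable
    (.of_forall fun x ↦ by simpa using norm_fractIoi_le x)

lemma fractIoi_isBigO_atTop : fractIoi =O[atTop] fun x : ℝ ↦ x ^ (-(0 : ℝ)) :=
  .of_bound 1 (.of_forall fun x ↦ by simpa using norm_fractIoi_le x)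

lemma fractIoi_isBigO_nhdsGT_zero (b : ℝ) : fractIoi =O[𝓝[>] 0] fun x : ℝ ↦ x ^ (-b) := by
  refine (isBigO_zero _ _).congr' ?_ .rfl
  filter_upwards [mem_nhdsWithin_of_mem_nhds (Iio_mem_nhds zero_lt_one)] with x hx
  exact (indicator_of_notMem (notMem_Ioi.mpr hx.le) _).symm

lemma differentiableAt_mellin_fractIoi {s : ℂ} (hs : s.re < 0) :
    DifferentiableAt ℂ (mellin fractIoi) s :=
  mellin_differentiableAt_of_isBigO_rpow (locallyIntegrable_fractIoi.locallyIntegrableOn _)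
    fractIoi_isBigO_atTop hs (fractIoi_isBigO_nhdsGT_zero (s.re - 1)) (by linarith)

lemma cpow_smul_fractIoi (s : ℂ) : (fun t : ℝ ↦ (t : ℂ) ^ (s - 1) • fractIoi t) =
    (Ioi (1 : ℝ)).indicator fun t ↦ (t : ℂ) ^ (s - 1) * (Int.fract t : ℝ) := by
  ext t
  by_cases ht : t ∈ Ioi (1 : ℝ) <;> simp [fractIoi, ht]

lemma integrableOn_cpow_mul_fract {s : ℂ} (hs : s.re < 0) :
    IntegrableOn (fun t : ℝ ↦ (t : ℂ) ^ (s - 1) * (Int.fract t : ℝ)) (Ioi 1) := by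
  have h : MellinConvergent fractIoi s :=
    mellinConvergent_of_isBigO_rpow (locallyIntegrable_fractIoi.locallyIntegrableOn _)
      fractIoi_isBigO_atTop hs (fractIoi_isBigO_nhdsGT_zero (s.re - 1)) (by linarith)
  rw [MellinConvergent, cpow_smul_fractIoi, IntegrableOn,
    integrable_indicator_iff measurableSet_Ioi, IntegrableOn,
    Measure.restrict_restrict measurableSet_Ioi] at h
  rwa [inter_eq_left.mpr (Ioi_subset_Ioi zero_le_one)] at h

lemma mellin_fractIoi (s : ℂ) :
    mellin fractIoi s = ∫ t in Ioi (1 : ℝ), (t : ℂ) ^ (s - 1) * (Int.fract t : ℝ) := by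
  rw [mellin, cpow_smul_fractIoi, setIntegral_indicator measurableSet_Ioi,
    inter_eq_right.mpr (Ioi_subset_Ioi zero_le_one)]

lemma riemannZeta_eq_of_one_lt_re {s : ℂ} (hs : 1 < s.re) :
    riemannZeta s = s / (s - 1) - s * mellin fractIoi (-s) := by
  have hs1 : s - 1 ≠ 0 := fun h ↦ by simp [sub_eq_zero.mp h] at hs
  have hO : (fun n : ℕ ↦ ∑ k ∈ Finset.Icc 1 n, (1 : ℝ)) =O[atTop] fun n ↦ (n : ℝ) ^ (1 : ℝ) := by
    simpa using isBigO_refl (fun n : ℕ ↦ (n : ℝ)) atTop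
  have key := LSeries_eq_mul_integral_of_nonneg (fun _ ↦ 1) zero_le_one hs hO
    (fun _ ↦ zero_le_one)
  have hI : IntegrableOn (fun t : ℝ ↦ (t : ℂ) ^ (-s)) (Ioi 1) :=
    integrableOn_Ioi_cpow_of_lt (by simpa using hs) one_pos
  have hsplit : ∫ t in Ioi (1 : ℝ), (∑ k ∈ Finset.Icc 1 ⌊t⌋₊, ((1 : ℝ) : ℂ)) * t ^ (-(s + 1)) =
      (∫ t in Ioi (1 : ℝ), (t : ℂ) ^ (-s)) - mellin fractIoi (-s) := by
    rw [mellin_fractIoi, ← integral_sub hI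
      (integrableOn_cpow_mul_fract (by rw [neg_re]; linarith))]
    refine setIntegral_congr_fun measurableSet_Ioi fun t (ht : 1 < t) ↦ ?_
    have ht0 : (t : ℂ) ≠ 0 := ofReal_ne_zero.mpr (by linarith)
    have hfl : ((⌊t⌋₊ : ℝ) : ℂ) = t - (Int.fract t : ℝ) := by
      rw [natCast_floor_eq_intCast_floor (by linarith), ← ofReal_sub, Int.self_sub_fract]
    have hpow : (t : ℂ) ^ (-s) = t * (t : ℂ) ^ (-s - 1) := by
      rw [cpow_sub _ _ ht0, cpow_one, mul_div_cancel₀ _ ht0]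
    have hsum : ∑ k ∈ Finset.Icc 1 ⌊t⌋₊, ((1 : ℝ) : ℂ) = ((⌊t⌋₊ : ℝ) : ℂ) := by simp
    simp only [hsum, hfl, hpow, neg_add']
    ring
  rw [hsplit, integral_Ioi_cpow_of_lt (by simpa using hs) one_pos] at key
  rw [← LSeries_one_eq_riemannZeta hs]
  have h1 : LSeries 1 s = LSeries (fun _ ↦ ((1 : ℝ) : ℂ)) s := by
    congr 1
  rw [h1, key, ofReal_one, one_cpow, show -s + 1 = -(s - 1) by ring]
  field_simp

lemma riemannZeta_eq_of_re_pos {s : ℂ} (hs : 0 < s.re) (hs1 : s ≠ 1) :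
    riemannZeta s = s / (s - 1) - s * mellin fractIoi (-s) := by
  have hopen : IsOpen {z : ℂ | 0 < z.re} := isOpen_lt continuous_const continuous_re
  have hf : AnalyticOnNhd ℂ riemannZeta₁ {z : ℂ | 0 < z.re} :=
    differentiable_riemannZeta₁.differentiableOn.analyticOnNhd hopen
  have hg : AnalyticOnNhd ℂ (fun z ↦ z - (z - 1) * (z * mellin fractIoi (-z)))
      {z : ℂ | 0 < z.re} := by
    refine DifferentiableOn.analyticOnNhd (fun z hz ↦ ?_) hopen
    have hm : DifferentiableAt ℂ (fun z ↦ mellin fractIoi (-z)) z :=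
      (differentiableAt_mellin_fractIoi (by simpa using hz)).comp z differentiable_neg.differentiableAt
    exact DifferentiableAt.differentiableWithinAt (by fun_prop)
  have heq := hf.eqOn_of_preconnected_of_eventuallyEq hg
    (convex_halfSpace_re_gt 0).isPreconnected (show (2 : ℂ) ∈ _ by simp) (by
      filter_upwards [(isOpen_lt continuous_const continuous_re).mem_nhds
        (show (2 : ℂ) ∈ {z : ℂ | 1 < z.re} by simp)] with z hz
      have hz1 : z ≠ 1 := by rintro rfl; simp at hz
      have := sub_ne_zero.mpr hz1
      have h := riemannZeta_eq_of_one_lt_re hz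
      rw [riemannZeta_eq_inv_sub_mul hz1] at h
      field_simp at h
      linear_combination h) hs
  have := sub_ne_zero.mpr hs1
  rw [riemannZeta_eq_inv_sub_mul hs1, heq]
  field_simp

lemma integral_cpow_mul_fract_of_riemannZeta_eq_zero {s : ℂ} (h0 : 0 < s.re) (h1 : s.re < 1)
    (hz : riemannZeta s = 0) :
    ∫ t in Ioi (1 : ℝ), (t : ℂ) ^ (s - 2) * (Int.fract t : ℝ) = -1 / s := by
  have hs0 : s ≠ 0 := by rintro rfl; simp at h0
  have hs1 : 1 - s ≠ 0 := fun h ↦ by simp [← sub_eq_zero.mp h] at h1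
  have hz' : riemannZeta (1 - s) = 0 := by
    rw [riemannZeta_one_sub, hz, mul_zero]
    · rintro n rfl
      simp at h0
      linarith [n.cast_nonneg (α := ℝ)]
    · exact (sub_ne_zero.mp hs1).symm
  rw [riemannZeta_eq_of_re_pos (by simpa using h1) (by simpa using hs0), mellin_fractIoi,
    show -(1 - s) - 1 = s - 2 by ring, show 1 - s - 1 = -s by ring] at hz'
  apply mul_left_cancel₀ hs1
  linear_combination -hz'

lemma im_cpow_ofReal {x : ℝ} (hx : 0 < x) (z : ℂ) :
    ((x : ℂ) ^ z).im = x ^ z.re * Real.sin (z.im * Real.log x) := by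
  rw [cpow_def_of_ne_zero (ofReal_ne_zero.mpr hx.ne'), ← ofReal_log hx.le, exp_im,
    re_ofReal_mul, im_ofReal_mul, Real.rpow_def_of_pos hx, mul_comm z.im]

theorem im_part_eq_two (a b : ℝ) (h0 : 0 < a) (h1 : a < 1)
    (hz : riemannZeta (a + b * Complex.I) = 0) :
    b / (a ^ 2 + b ^ 2) =
      ∫ x : ℝ in Set.Ioi (1 : ℝ), Int.fract x * Real.sin (b * Real.log x) / x ^ (2 - a) := by
  have hint := integrableOn_cpow_mul_fract (s := a + b * I - 1) (by simpa using h1)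
  have h := congrArg im (integral_cpow_mul_fract_of_riemannZeta_eq_zero
    (s := a + b * I) (by simpa using h0) (by simpa using h1) hz)
  rw [show (a + b * I - 1 - 1 : ℂ) = a + b * I - 2 by ring] at hint
  have him : (-1 / (a + b * I : ℂ)).im = b / (a ^ 2 + b ^ 2) := by
    simp [normSq_apply, sq, neg_div]
  rw [← him, ← h]
  refine (integral_im hint).symm.trans (setIntegral_congr_fun measurableSet_Ioi
    fun x (hx : 1 < x) ↦ ?_)
  have hx0 : 0 < x := one_pos.trans hx
  have hpow : x ^ (a - 2) = (x ^ (2 - a))⁻¹ := by rw [← Real.rpow_neg hx0.le, neg_sub]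
  change ((x : ℂ) ^ (a + b * I - 2) * (Int.fract x : ℝ)).im = _
  rw [im_mul_ofReal, im_cpow_ofReal hx0]
  simp [hpow]
  ring
end
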